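/- arXiv:2207.06454 — 2 statements merged into one kernel-verified Lean document; each statement's English description precedes it below -/
import Mathlib

section
/- The automorphism group of H has order 432, i.e. Nat.card (MulAut H) = 432. -/
open Matrix

/-- The set of upper unitriangular matrices inside `GL (Fin 3) (ZMod 3)`:
entries `1` on the diagonal and `0` below the diagonal. -/
def UTcarrier : Set (GL (Fin 3) (ZMod 3)) :=
  {A | (∀ i j : Fin 3, j < i → (A : Matrix (Fin 3) (Fin 3) (ZMod 3)) i j = 0) ∧
       (∀ i : Fin 3, (A : Matrix (Fin 3) (Fin 3) (ZMod 3)) i i = 1)}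

lemma UT_one_mem : (1 : GL (Fin 3) (ZMod 3)) ∈ UTcarrier := by
  constructor
  · intro i j hij
    exact Matrix.one_apply_ne (ne_of_gt hij)
  · intro i
    simp [Matrix.one_apply]

lemma UT_mul_mem {a b : GL (Fin 3) (ZMod 3)} (ha : a ∈ UTcarrier) (hb : b ∈ UTcarrier) :
    a * b ∈ UTcarrier := by
  obtain ⟨ha1, ha2⟩ := ha
  obtain ⟨hb1, hb2⟩ := hb
  have a10 := ha1 1 0 (by decide)
  have a20 := ha1 2 0 (by decide)
  have a21 := ha1 2 1 (by decide)
  have b10 := hb1 1 0 (by decide)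
  have b20 := hb1 2 0 (by decide)
  have b21 := hb1 2 1 (by decide)
  have a00 := ha2 0; have a11 := ha2 1; have a22 := ha2 2
  have b00 := hb2 0; have b11 := hb2 1; have b22 := hb2 2
  have hval : ((a * b : GL (Fin 3) (ZMod 3)) : Matrix (Fin 3) (Fin 3) (ZMod 3))
      = (a : Matrix (Fin 3) (Fin 3) (ZMod 3)) * (b : Matrix (Fin 3) (Fin 3) (ZMod 3)) :=
    Units.val_mul a b
  constructor
  · intro i j hij
    rw [hval, Matrix.mul_apply, Fin.sum_univ_three]
    fin_cases i <;> fin_cases j <;> simp_all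
  · intro i
    rw [hval, Matrix.mul_apply, Fin.sum_univ_three]
    fin_cases i <;> simp_all

lemma UT_inv_mem {x : GL (Fin 3) (ZMod 3)} (hx : x ∈ UTcarrier) : x⁻¹ ∈ UTcarrier := by
  have hpow : ∀ n : ℕ, x ^ n ∈ UTcarrier := by
    intro n
    induction n with
    | zero => simpa using UT_one_mem
    | succ n ih => rw [pow_succ]; exact UT_mul_mem ih hx
  have hmul : x * x ^ (orderOf x - 1) = 1 := by
    rw [← pow_succ', Nat.sub_add_cancel (Nat.one_le_iff_ne_zero.mpr (orderOf_pos x).ne')]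
    exact pow_orderOf_eq_one x
  have key : x⁻¹ = x ^ (orderOf x - 1) := inv_eq_of_mul_eq_one_right hmul
  rw [key]
  exact hpow _

/-- `H`: the group of upper unitriangular `3 × 3` matrices over `ZMod 3`, i.e. the
extraspecial group `3₊^{1+2}` of order `27` and exponent `3`. -/
def H : Subgroup (GL (Fin 3) (ZMod 3)) where
  carrier := UTcarrier
  one_mem' := UT_one_mem
  mul_mem' := UT_mul_mem
  inv_mem' := UT_inv_mem

/-- The unitriangular matrix with entries `a`, `b` above the diagonal and `c` in the corner. -/
def unitri (a b c : ZMod 3) : H :=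
  ⟨⟨!![1, a, c; 0, 1, b; 0, 0, 1], !![1, -a, a * b - c; 0, 1, -b; 0, 0, 1],
    by
      ext i j
      fin_cases i <;> fin_cases j <;> simp [Matrix.mul_apply, Fin.sum_univ_three]
      ring,
    by
      ext i j
      fin_cases i <;> fin_cases j <;> simp [Matrix.mul_apply, Fin.sum_univ_three]
      ring⟩,
    by
      constructor
      · intro i j hij
        fin_cases i <;> fin_cases j <;> simp_all
      · intro i
        fin_cases i <;> simp⟩

/-- The entries above the diagonal identify `H` with `(ZMod 3)³`. -/
def unitriEquiv : H ≃ ZMod 3 × ZMod 3 × ZMod 3 where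
  toFun g := (g.1.1 0 1, g.1.1 1 2, g.1.1 0 2)
  invFun v := unitri v.1 v.2.1 v.2.2
  left_inv g := by
    obtain ⟨g, h0, h1⟩ := g
    apply Subtype.ext
    apply Units.ext
    have h10 := h0 1 0 (by decide)
    have h20 := h0 2 0 (by decide)
    have h21 := h0 2 1 (by decide)
    ext i j
    fin_cases i <;> fin_cases j <;> simp_all [unitri]
  right_inv v := by simp [unitri]

lemma exists_unitri (g : H) : ∃ a b c, unitri a b c = g :=
  ⟨_, _, _, unitriEquiv.left_inv g⟩

@[simp]
lemma unitriEquiv_unitri (a b c : ZMod 3) : unitriEquiv (unitri a b c) = (a, b, c) :=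
  unitriEquiv.right_inv (a, b, c)

lemma unitri_inj {a b c a' b' c' : ZMod 3} :
    unitri a b c = unitri a' b' c' ↔ a = a' ∧ b = b' ∧ c = c' := by
  rw [← unitriEquiv.injective.eq_iff]
  simp

lemma unitri_mul (a b c a' b' c' : ZMod 3) :
    unitri a b c * unitri a' b' c' = unitri (a + a') (b + b') (c + c' + a * b') := by
  apply Subtype.ext
  apply Units.ext
  ext i j
  fin_cases i <;> fin_cases j <;>
    simp [unitri, Matrix.mul_apply, Fin.sum_univ_three] <;> ring

lemma unitri_zero : unitri 0 0 0 = 1 := by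
  have h := unitri_mul 0 0 0 0 0 0
  simpa using h

lemma unitri_fst_pow (n : ℕ) : unitri 1 0 0 ^ n = unitri n 0 0 := by
  induction n with
  | zero => simp [unitri_zero]
  | succ n ih => simp [pow_succ, ih, unitri_mul]

lemma unitri_snd_pow (n : ℕ) : unitri 0 1 0 ^ n = unitri 0 n 0 := by
  induction n with
  | zero => simp [unitri_zero]
  | succ n ih => simp [pow_succ, ih, unitri_mul]

lemma unitri_corner_pow (n : ℕ) : unitri 0 0 1 ^ n = unitri 0 0 n := by
  induction n with
  | zero => simp [unitri_zero]
  | succ n ih => simp [pow_succ, ih, unitri_mul]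

lemma unitri_eq_pow (a b c : ZMod 3) :
    unitri a b c = unitri 0 1 0 ^ b.val * unitri 1 0 0 ^ a.val * unitri 0 0 1 ^ c.val := by
  simp [unitri_fst_pow, unitri_snd_pow, unitri_corner_pow, unitri_mul]

lemma unitri_corner_eq :
    unitri 0 0 1 = (unitri 0 1 0 * unitri 1 0 0)⁻¹ * (unitri 1 0 0 * unitri 0 1 0) := by
  rw [eq_inv_mul_iff_mul_eq]
  simp [unitri_mul]

lemma monoidHom_ext_unitri {f g : H →* H} (hx : f (unitri 1 0 0) = g (unitri 1 0 0))
    (hy : f (unitri 0 1 0) = g (unitri 0 1 0)) : f = g := by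
  have hz : f (unitri 0 0 1) = g (unitri 0 0 1) := by
    rw [unitri_corner_eq]
    simp only [map_mul, map_inv, hx, hy]
  ext1 h
  obtain ⟨a, b, c, rfl⟩ := exists_unitri h
  rw [unitri_eq_pow]
  simp only [map_mul, map_pow, hx, hy, hz]

/-- The determinant of the images of two elements of `H` in the abelianization `(ZMod 3)²`. -/
def abDet (v w : ZMod 3 × ZMod 3 × ZMod 3) : ZMod 3 :=
  v.1 * w.2.1 - v.2.1 * w.1

lemma commute_iff_abDet_eq_zero (g h : H) :
    Commute g h ↔ abDet (unitriEquiv g) (unitriEquiv h) = 0 := by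
  obtain ⟨a, b, c, rfl⟩ := exists_unitri g
  obtain ⟨a', b', c', rfl⟩ := exists_unitri h
  simp only [commute_iff_eq, unitri_mul, unitri_inj, unitriEquiv_unitri, abDet]
  constructor
  · rintro ⟨-, -, h⟩
    linear_combination h
  · intro h
    exact ⟨by ring, by ring, by linear_combination h⟩

/-- The endomorphism of `H` sending the two standard generators to the elements with
coordinates `v` and `w`. The formula expands `y ^ b * x ^ a * ⁅x, y⁆ ^ c`. -/
def endOfImages (v w : ZMod 3 × ZMod 3 × ZMod 3) : H →* H :=
  MonoidHom.mk'
    (fun g =>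
      let (a, b, c) := unitriEquiv g
      unitri (a * v.1 + b * w.1) (a * v.2.1 + b * w.2.1)
        (a * v.2.2 + (a - a ^ 2) * (v.1 * v.2.1) + b * w.2.2 + (b - b ^ 2) * (w.1 * w.2.1) +
          a * b * (w.1 * v.2.1) + c * abDet v w))
    (by
      intro g h
      obtain ⟨a, b, c, rfl⟩ := exists_unitri g
      obtain ⟨a', b', c', rfl⟩ := exists_unitri h
      have h3 : (3 : ZMod 3) = 0 := rfl
      simp only [unitri_mul, unitriEquiv_unitri, unitri_inj, abDet]
      refine ⟨by ring, by ring, ?_⟩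
      linear_combination (-(a * a' * v.1 * v.2.1) - b * b' * w.1 * w.2.1) * h3)

lemma endOfImages_unitri (v w : ZMod 3 × ZMod 3 × ZMod 3) (a b c : ZMod 3) :
    endOfImages v w (unitri a b c) =
      unitri (a * v.1 + b * w.1) (a * v.2.1 + b * w.2.1)
        (a * v.2.2 + (a - a ^ 2) * (v.1 * v.2.1) + b * w.2.2 + (b - b ^ 2) * (w.1 * w.2.1) +
          a * b * (w.1 * v.2.1) + c * abDet v w) := by
  simp [endOfImages]

lemma endOfImages_fst (v w : ZMod 3 × ZMod 3 × ZMod 3) :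
    endOfImages v w (unitri 1 0 0) = unitriEquiv.symm v := by
  simp [endOfImages_unitri, unitriEquiv]

lemma endOfImages_snd (v w : ZMod 3 × ZMod 3 × ZMod 3) :
    endOfImages v w (unitri 0 1 0) = unitriEquiv.symm w := by
  simp [endOfImages_unitri, unitriEquiv]

lemma endOfImages_bijective {v w : ZMod 3 × ZMod 3 × ZMod 3} (h : abDet v w ≠ 0) :
    Function.Bijective (endOfImages v w) := by
  have : Finite H := Finite.of_equiv _ unitriEquiv.symm
  rw [← Finite.injective_iff_bijective, injective_iff_map_eq_one]
  intro g hg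
  obtain ⟨a, b, c, rfl⟩ := exists_unitri g
  rw [endOfImages_unitri, ← unitri_zero, unitri_inj] at hg
  obtain ⟨h1, h2, h3⟩ := hg
  have ha : a = 0 := by
    refine (mul_eq_zero.mp ?_).resolve_right h
    simp only [abDet]
    linear_combination w.2.1 * h1 - w.1 * h2
  have hb : b = 0 := by
    refine (mul_eq_zero.mp ?_).resolve_right h
    simp only [abDet]
    linear_combination v.1 * h2 - v.2.1 * h1
  subst ha hb
  have hc : c = 0 := by simpa [h] using h3
  rw [hc, unitri_zero]

/-- Automorphisms of `H` correspond to pairs of elements of `H` with independent images in the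
abelianization. -/
noncomputable def mulAutEquiv :
    MulAut H ≃ {p : (ZMod 3 × ZMod 3 × ZMod 3) × (ZMod 3 × ZMod 3 × ZMod 3) //
      abDet p.1 p.2 ≠ 0} where
  toFun f := ⟨(unitriEquiv (f (unitri 1 0 0)), unitriEquiv (f (unitri 0 1 0))), by
    rw [ne_eq, ← commute_iff_abDet_eq_zero, commute_iff_eq, ← map_mul, ← map_mul,
      f.injective.eq_iff, ← commute_iff_eq, commute_iff_abDet_eq_zero]
    simp [abDet]⟩
  invFun p := MulEquiv.ofBijective (endOfImages p.1.1 p.1.2) (endOfImages_bijective p.2)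
  left_inv f := by
    apply MulEquiv.toMonoidHom_injective
    apply monoidHom_ext_unitri
    · simp [endOfImages_fst]
    · simp [endOfImages_snd]
  right_inv p := by
    simp [endOfImages_fst, endOfImages_snd]

theorem card_mulAut_H : Nat.card (MulAut ↥H) = 432 := by
  rw [Nat.card_congr mulAutEquiv, Nat.card_eq_fintype_card]
  decide +kernel
end

section
/- The center of H is a normal subgroup, and the natural group homomorphism MulAut H → MulAut (H ⧸ Subgroup.center H), sending an automorphism of H to the induced automorphism of the quotient H ⧸ center H (which is well defined because every automorphism preserves the center), is surjective and its kernel is exactly the subgroup of inner automorphisms of H (the image of the conjugation homomorphism H → MulAut H). -/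
open Matrix

/-- Every automorphism of a group maps the center onto the center. -/
lemma center_map_eq {G : Type*} [Group G] (phi : G ≃* G) :
    (Subgroup.center G).map phi.toMonoidHom = Subgroup.center G :=
  Subgroup.characteristic_iff_map_eq.mp Subgroup.centerCharacteristic phi

/-- The automorphism of `H ⧸ center H` induced by an automorphism of `H`
(well defined because every automorphism preserves the center). -/
def inducedQuotAut (phi : MulAut ↥H) : MulAut (↥H ⧸ Subgroup.center ↥H) :=
  QuotientGroup.congr (Subgroup.center ↥H) (Subgroup.center ↥H) phi (center_map_eq phi)

/-- The natural group homomorphism `MulAut H →* MulAut (H ⧸ center H)` sending an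
automorphism of `H` to the induced automorphism of the quotient. -/
def inducedQuotHom : MulAut ↥H →* MulAut (↥H ⧸ Subgroup.center ↥H) :=
  MonoidHom.mk' inducedQuotAut (by
    intro a b
    ext x
    induction x using QuotientGroup.induction_on
    rfl)

namespace H

/-- The unitriangular matrix with superdiagonal entries `a`, `b` and corner entry `c`. -/
def mk (a b c : ZMod 3) : ↥H :=
  ⟨Matrix.GeneralLinearGroup.mkOfDetNeZero !![1, a, c; 0, 1, b; 0, 0, 1]
    (by simp [Matrix.det_fin_three]), by
    constructor
    · intro i j hij
      fin_cases i <;> fin_cases j <;>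
        simp_all [Matrix.GeneralLinearGroup.mkOfDetNeZero]
    · intro i
      fin_cases i <;> simp [Matrix.GeneralLinearGroup.mkOfDetNeZero]⟩

lemma coe_mk (a b c : ZMod 3) :
    ((mk a b c : GL (Fin 3) (ZMod 3)) : Matrix (Fin 3) (Fin 3) (ZMod 3)) =
      !![1, a, c; 0, 1, b; 0, 0, 1] := rfl

lemma exists_eq_mk (x : ↥H) : ∃ a b c, x = mk a b c := by
  obtain ⟨x, h0, h1⟩ := x
  refine ⟨x 0 1, x 1 2, x 0 2, Subtype.ext (Units.ext ?_)⟩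
  rw [coe_mk]
  ext i j
  fin_cases i <;> fin_cases j <;> simp [h0, h1]

@[simp]
lemma mk_inj {a b c a' b' c' : ZMod 3} :
    mk a b c = mk a' b' c' ↔ a = a' ∧ b = b' ∧ c = c' := by
  refine ⟨fun h => ?_, by rintro ⟨rfl, rfl, rfl⟩; rfl⟩
  have h' := congrArg
    (fun x : ↥H => ((x : GL (Fin 3) (ZMod 3)) : Matrix (Fin 3) (Fin 3) (ZMod 3))) h
  simp only [coe_mk] at h'
  exact ⟨by simpa using congrFun₂ h' 0 1, by simpa using congrFun₂ h' 1 2,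
    by simpa using congrFun₂ h' 0 2⟩

@[simp]
lemma mk_mul_mk (a b c a' b' c' : ZMod 3) :
    mk a b c * mk a' b' c' = mk (a + a') (b + b') (c + c' + a * b') := by
  apply Subtype.ext
  apply Units.ext
  rw [Subgroup.coe_mul, Units.val_mul, coe_mk, coe_mk, coe_mk]
  ext i j
  fin_cases i <;> fin_cases j <;> simp [Matrix.mul_apply, Fin.sum_univ_three] <;> ring

lemma mk_zero : mk 0 0 0 = 1 := by
  have h : mk 0 0 0 * mk 0 0 0 = mk 0 0 0 := by simp
  exact mul_eq_left.mp h

lemma mk_mem_center {a b c : ZMod 3} :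
    mk a b c ∈ Subgroup.center ↥H ↔ a = 0 ∧ b = 0 := by
  rw [Subgroup.mem_center_iff]
  constructor
  · intro h
    have h₁ := h (mk 1 0 0)
    have h₂ := h (mk 0 1 0)
    simp only [mk_mul_mk, mk_inj] at h₁ h₂
    exact ⟨by simpa using h₂.2.2.symm, by simpa using h₁.2.2⟩
  · rintro ⟨rfl, rfl⟩ g
    obtain ⟨a', b', c', rfl⟩ := exists_eq_mk g
    simp [add_comm]

lemma quotient_mk_eq_iff {a b c a' b' c' : ZMod 3} :
    (mk a b c : ↥H ⧸ Subgroup.center ↥H) = mk a' b' c' ↔ a = a' ∧ b = b' := by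
  rw [QuotientGroup.eq]
  obtain ⟨u, v, w, h⟩ := exists_eq_mk ((mk a b c)⁻¹ * mk a' b' c')
  rw [h, mk_mem_center]
  rw [inv_mul_eq_iff_eq_mul, mk_mul_mk, mk_inj] at h
  rw [h.1, h.2.1]
  simp

lemma mk_one_zero_zero_pow (n : ℕ) : mk 1 0 0 ^ n = mk n 0 0 := by
  induction n with
  | zero => simp [mk_zero]
  | succ n ih => simp [pow_succ, ih]

lemma mk_zero_one_zero_pow (n : ℕ) : mk 0 1 0 ^ n = mk 0 n 0 := by
  induction n with
  | zero => simp [mk_zero]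
  | succ n ih => simp [pow_succ, ih]

lemma mk_zero_zero_one_pow (n : ℕ) : mk 0 0 1 ^ n = mk 0 0 n := by
  induction n with
  | zero => simp [mk_zero]
  | succ n ih => simp [pow_succ, ih]

/-- Homomorphisms out of `H` are determined by their values on the two standard generators. -/
lemma hom_ext {G : Type*} [Group G] {f g : ↥H →* G}
    (h₁ : f (mk 1 0 0) = g (mk 1 0 0)) (h₂ : f (mk 0 1 0) = g (mk 0 1 0)) : f = g := by
  have hc : mk 1 0 0 * mk 0 1 0 = mk 0 1 0 * mk 1 0 0 * mk 0 0 1 := by simp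
  have h₃ : f (mk 0 0 1) = g (mk 0 0 1) := by
    have hf := congrArg f hc
    have hg := congrArg g hc
    simp only [map_mul] at hf hg
    rw [h₁, h₂, hg] at hf
    exact (mul_left_cancel hf).symm
  ext x
  obtain ⟨a, b, c, rfl⟩ := exists_eq_mk x
  have hx : mk a b c = mk 0 1 0 ^ b.val * mk 1 0 0 ^ a.val * mk 0 0 1 ^ c.val := by
    simp [mk_one_zero_zero_pow, mk_zero_one_zero_pow, mk_zero_zero_one_pow]
  simp only [hx, map_mul, map_pow, h₁, h₂, h₃]

/-- The endomorphism of `H` lifting the linear map with matrix `!![p, q; r, s]` on `H ⧸ center H`.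
In the coordinate `c + a * b` the group law is the addition twisted by a symplectic form, and the
lift scales this coordinate by the determinant. -/
def lift (p q r s : ZMod 3) : ↥H →* ↥H :=
  MonoidHom.mk' (fun x =>
    let a := (x : GL (Fin 3) (ZMod 3)) 0 1
    let b := (x : GL (Fin 3) (ZMod 3)) 1 2
    let c := (x : GL (Fin 3) (ZMod 3)) 0 2
    mk (p * a + q * b) (r * a + s * b)
      ((p * s - q * r) * (c + a * b) - (p * a + q * b) * (r * a + s * b))) (by
    intro x y
    obtain ⟨a, b, c, rfl⟩ := exists_eq_mk x
    obtain ⟨a', b', c', rfl⟩ := exists_eq_mk y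
    have h3 : (3 : ZMod 3) = 0 := rfl
    simp only [mk_mul_mk, mk_inj, coe_mk, Matrix.of_apply, Matrix.cons_val]
    refine ⟨by ring, by ring, ?_⟩
    linear_combination
      ((p * s - q * r) * a * b' - (p * a + q * b) * (r * a' + s * b')) * h3)

lemma lift_mk (p q r s a b c : ZMod 3) :
    lift p q r s (mk a b c) = mk (p * a + q * b) (r * a + s * b)
      ((p * s - q * r) * (c + a * b) - (p * a + q * b) * (r * a + s * b)) := rfl

lemma lift_bijective {p q r s : ZMod 3} (hd : p * s - q * r ≠ 0) :
    Function.Bijective (lift p q r s) := by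
  rw [← Finite.injective_iff_bijective, injective_iff_map_eq_one]
  intro x hx
  obtain ⟨a, b, c, rfl⟩ := exists_eq_mk x
  rw [lift_mk, ← mk_zero, mk_inj] at hx
  obtain ⟨h₁, h₂, h₃⟩ := hx
  have ha : a = 0 := (mul_eq_zero.mp (by linear_combination s * h₁ - q * h₂ :
    (p * s - q * r) * a = 0)).resolve_left hd
  have hb : b = 0 := (mul_eq_zero.mp (by linear_combination p * h₂ - r * h₁ :
    (p * s - q * r) * b = 0)).resolve_left hd
  subst ha hb
  have hc : c = 0 := (mul_eq_zero.mp (by linear_combination h₃ :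
    (p * s - q * r) * c = 0)).resolve_left hd
  rw [hc, mk_zero]

end H

lemma inducedQuotHom_apply_mk (phi : MulAut ↥H) (x : ↥H) :
    inducedQuotHom phi (x : ↥H ⧸ Subgroup.center ↥H) = (phi x : ↥H) := rfl

lemma inducedQuotHom_surjective : Function.Surjective inducedQuotHom := by
  intro psi
  obtain ⟨x, hx⟩ := QuotientGroup.mk_surjective (psi (H.mk 1 0 0 : ↥H))
  obtain ⟨y, hy⟩ := QuotientGroup.mk_surjective (psi (H.mk 0 1 0 : ↥H))
  obtain ⟨p, r, t, rfl⟩ := H.exists_eq_mk x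
  obtain ⟨q, s, u, rfl⟩ := H.exists_eq_mk y
  have hlift : (QuotientGroup.mk' (Subgroup.center ↥H)).comp (H.lift p q r s) =
      psi.toMonoidHom.comp (QuotientGroup.mk' (Subgroup.center ↥H)) := by
    apply H.hom_ext
    · refine Eq.trans ?_ hx
      rw [MonoidHom.comp_apply, H.lift_mk]
      exact H.quotient_mk_eq_iff.mpr ⟨by simp, by simp⟩
    · refine Eq.trans ?_ hy
      rw [MonoidHom.comp_apply, H.lift_mk]
      exact H.quotient_mk_eq_iff.mpr ⟨by simp, by simp⟩
  have hcoe (z : ↥H) : ((H.lift p q r s z : ↥H) : ↥H ⧸ Subgroup.center ↥H) = psi z :=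
    DFunLike.congr_fun hlift z
  have hsurj (a b : ZMod 3) : ∃ a' b', p * a' + q * b' = a ∧ r * a' + s * b' = b := by
    obtain ⟨w, hw⟩ := psi.surjective (H.mk a b 0 : ↥H)
    obtain ⟨z, rfl⟩ := QuotientGroup.mk_surjective w
    obtain ⟨a', b', c', rfl⟩ := H.exists_eq_mk z
    rw [← hcoe, H.lift_mk, H.quotient_mk_eq_iff] at hw
    exact ⟨a', b', hw⟩
  obtain ⟨a, b, h₁, h₂⟩ := hsurj 1 0
  obtain ⟨a', b', h₃, h₄⟩ := hsurj 0 1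
  have hd : p * s - q * r ≠ 0 := by
    intro hd
    apply one_ne_zero (α := ZMod 3)
    linear_combination (a * b' - a' * b) * hd - h₁ * (r * a' + s * b') - h₄ + h₂ * (p * a' + q * b')
  refine ⟨MulEquiv.ofBijective (H.lift p q r s) (H.lift_bijective hd), ?_⟩
  ext w
  obtain ⟨z, rfl⟩ := QuotientGroup.mk_surjective w
  exact hcoe z

lemma inducedQuotHom_ker : inducedQuotHom.ker = (MulAut.conj : ↥H →* MulAut ↥H).range := by
  ext phi
  rw [MonoidHom.mem_ker, MonoidHom.mem_range]
  constructor
  · intro h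
    have hphi (x : ↥H) : ((phi x : ↥H) : ↥H ⧸ Subgroup.center ↥H) = x := by
      rw [← inducedQuotHom_apply_mk, h, MulAut.one_apply]
    obtain ⟨a, b, u, hu⟩ := H.exists_eq_mk (phi (H.mk 1 0 0))
    obtain ⟨a', b', v, hv⟩ := H.exists_eq_mk (phi (H.mk 0 1 0))
    have h₁ := hphi (H.mk 1 0 0)
    have h₂ := hphi (H.mk 0 1 0)
    rw [hu, H.quotient_mk_eq_iff] at h₁
    rw [hv, H.quotient_mk_eq_iff] at h₂
    obtain ⟨rfl, rfl⟩ := h₁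
    obtain ⟨rfl, rfl⟩ := h₂
    refine ⟨H.mk v (-u) 0, ?_⟩
    have key : (MulAut.conj (H.mk v (-u) 0)).toMonoidHom = phi.toMonoidHom := by
      apply H.hom_ext
      · change H.mk v (-u) 0 * H.mk 1 0 0 * (H.mk v (-u) 0)⁻¹ = phi (H.mk 1 0 0)
        rw [hu, mul_inv_eq_iff_eq_mul]
        simp [add_comm]
      · change H.mk v (-u) 0 * H.mk 0 1 0 * (H.mk v (-u) 0)⁻¹ = phi (H.mk 0 1 0)
        rw [hv, mul_inv_eq_iff_eq_mul]
        simp [add_comm]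
    exact MulEquiv.toMonoidHom_injective key
  · rintro ⟨g, rfl⟩
    ext w
    obtain ⟨x, rfl⟩ := QuotientGroup.mk_surjective w
    rw [inducedQuotHom_apply_mk, MulAut.one_apply, MulAut.conj_apply]
    obtain ⟨a, b, c, rfl⟩ := H.exists_eq_mk x
    obtain ⟨a', b', c', h⟩ := H.exists_eq_mk (g * H.mk a b c * g⁻¹)
    obtain ⟨u, v, w, rfl⟩ := H.exists_eq_mk g
    rw [h, H.quotient_mk_eq_iff]
    rw [mul_inv_eq_iff_eq_mul, H.mk_mul_mk, H.mk_mul_mk, H.mk_inj] at h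
    exact ⟨by linear_combination -h.1, by linear_combination -h.2.1⟩

theorem inducedQuotHom_surjective_and_ker_eq_inn :
    (Subgroup.center ↥H).Normal ∧
    Function.Surjective inducedQuotHom ∧
    inducedQuotHom.ker = (MulAut.conj : ↥H →* MulAut ↥H).range := by
  exact ⟨inferInstance, inducedQuotHom_surjective, inducedQuotHom_ker⟩
end
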